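/- arXiv:1708.06443 — 3 statements merged into one kernel-verified Lean document; each statement's English description precedes it below -/
import Mathlib

section
/- In the canonical two-stage model with ℓ ≥ 4, let p ∈ (0, 2(ℓ−2)/s), let c(x*) = ‖x_z‖²/(‖x_z‖² + p‖x_r‖²), and let β̂ be the control-function estimator with control vector b(X*) = ((1−c(X*))(X*_z)', (X*_r)')'. Let β̂_2SLS = (Y*_z)'X*_z/‖X*_z‖² be the two-stage least-squares estimator. If ρ ≠ 0 and μ ≠ 0, then |E[β̂] − β| < |E[β̂_2SLS] − β|; if ρ = 0 or μ = 0, then |E[β̂] − β| = |E[β̂_2SLS] − β|. -/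
open MeasureTheory ProbabilityTheory Matrix

/-- Marginal law of `X* = (X*_z, X*_r)` in the canonical two-stage model:
independent coordinates, `X*_z ~ N(μ, τ²I_ℓ)` and `X*_r ~ N(0, τ²I_s)`. -/
noncomputable def lawX (ℓ s : ℕ) (μ : Fin ℓ → ℝ) (τ : ℝ) :
    Measure (Fin ℓ ⊕ Fin s → ℝ) :=
  Measure.pi fun i => gaussianReal (Sum.elim μ (0 : Fin s → ℝ) i) (τ ^ 2).toNNReal

/-- Conditional law of `Y*` given `X* = x`: independent coordinates with
`Y*_i ~ N(x_i β + (x_i − μ₀_i)(ρσ/τ), (1−ρ²)σ²)`, where `μ₀ = (μ', 0'_s)'`. -/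
noncomputable def lawYgiven (ℓ s : ℕ) (μ : Fin ℓ → ℝ) (β ρ σ τ : ℝ)
    (x : Fin ℓ ⊕ Fin s → ℝ) : Measure (Fin ℓ ⊕ Fin s → ℝ) :=
  Measure.pi fun i =>
    gaussianReal (x i * β + (x i - Sum.elim μ (0 : Fin s → ℝ) i) * (ρ * σ / τ))
      ((1 - ρ ^ 2) * σ ^ 2).toNNReal

/-- The shrinkage factor `c(x*) = ‖x_z‖²/(‖x_z‖² + p ‖x_r‖²)`. -/
noncomputable def shrinkC {ℓ s : ℕ} (p : ℝ) (x : Fin ℓ ⊕ Fin s → ℝ) : ℝ :=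
  (∑ i, x (Sum.inl i) ^ 2) / ((∑ i, x (Sum.inl i) ^ 2) + p * ∑ j, x (Sum.inr j) ^ 2)

/-- The control vector `b(x*) = ((1 − c(x*))(x*_z)', (x*_r)')'`. -/
noncomputable def bShrink {ℓ s : ℕ} (p : ℝ) (x : Fin ℓ ⊕ Fin s → ℝ) :
    Fin ℓ ⊕ Fin s → ℝ :=
  Sum.elim ((1 - shrinkC p x) • fun i => x (Sum.inl i)) (fun j => x (Sum.inr j))

/-- The annihilator matrix `a = I − b(b'b)⁻¹b'` associated with a control vector `b`. -/
noncomputable def annih {ι : Type*} [Fintype ι] [DecidableEq ι] (b : ι → ℝ) :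
    Matrix ι ι ℝ :=
  1 - (b ⬝ᵥ b)⁻¹ • Matrix.vecMulVec b b

/-- The control-function estimator `β̂ = x'a y/(x'a x)` with control vector `b`. -/
noncomputable def cfEst {ι : Type*} [Fintype ι] [DecidableEq ι]
    (b x y : ι → ℝ) : ℝ :=
  (x ⬝ᵥ (annih b).mulVec y) / (x ⬝ᵥ (annih b).mulVec x)

open scoped NNReal

lemma integral_mul_exp_neg_sq_gaussianReal (m : ℝ) {v : ℝ≥0} (hv : v ≠ 0) {t : ℝ} (ht : 0 ≤ t)
    (g : ℝ → ℝ) :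
    ∫ x, g x * Real.exp (-(t * x ^ 2)) ∂gaussianReal m v =
      (√(1 + 2 * v * t))⁻¹ * Real.exp (-(t * m ^ 2 / (1 + 2 * v * t))) *
        ∫ x, g x ∂gaussianReal (m / (1 + 2 * v * t)) (v / (1 + 2 * v * t)).toNNReal := by
  have hv0 : (0 : ℝ) < v := by positivity
  set u : ℝ := 1 + 2 * v * t with hu
  have hu0 : 0 < u := by positivity
  have hw : ((v : ℝ) / u).toNNReal ≠ 0 := by
    simpa using div_pos hv0 hu0
  rw [integral_gaussianReal_eq_integral_smul hv, integral_gaussianReal_eq_integral_smul hw,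
    ← integral_const_mul]
  congr 1 with x
  simp only [gaussianPDFReal, smul_eq_mul, Real.coe_toNNReal _ (div_pos hv0 hu0).le]
  have h1 : √(2 * Real.pi * (v / u)) = √(2 * Real.pi * v) * (√u)⁻¹ := by
    rw [← mul_div_assoc, Real.sqrt_div (by positivity), div_eq_mul_inv]
  have h2 : Real.exp (-(x - m) ^ 2 / (2 * v)) * Real.exp (-(t * x ^ 2)) =
      Real.exp (-(t * m ^ 2 / u)) * Real.exp (-(x - m / u) ^ 2 / (2 * (v / u))) := by
    rw [← Real.exp_add, ← Real.exp_add]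
    congr 1
    have ht' : t = (u - 1) / (2 * v) := by rw [hu]; field_simp; ring
    rw [ht']
    field_simp
    ring
  have hs : √u ≠ 0 := by positivity
  rw [h1, mul_inv, inv_inv]
  calc _ = (√(2 * Real.pi * v))⁻¹ * g x *
      (Real.exp (-(x - m) ^ 2 / (2 * v)) * Real.exp (-(t * x ^ 2))) := by ring
    _ = _ := by rw [h2]; field_simp

/-- The Laplace transform of `∑ i, z i ^ 2` when the `z i` are independent `N(μ i, v)`,
with `n` coordinates and `m = ∑ i, μ i ^ 2`. -/
noncomputable def sqLaplace (n v m t : ℝ) : ℝ :=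
  (1 + 2 * v * t) ^ (-(n / 2)) * Real.exp (-(t * m / (1 + 2 * v * t)))

lemma prod_gaussian_factor {ι : Type*} [Fintype ι] (μ : ι → ℝ) (v : ℝ≥0) {t : ℝ} (ht : 0 ≤ t) :
    ∏ i, ((√(1 + 2 * v * t))⁻¹ * Real.exp (-(t * μ i ^ 2 / (1 + 2 * v * t)))) =
      sqLaplace (Fintype.card ι) v (∑ i, μ i ^ 2) t := by
  have hu0 : (0 : ℝ) ≤ 1 + 2 * v * t := by positivity
  rw [Finset.prod_mul_distrib, Finset.prod_const, Finset.card_univ, ← Real.exp_sum,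
    Finset.sum_neg_distrib, ← Finset.sum_div, ← Finset.mul_sum, sqLaplace]
  congr 1
  rw [Real.sqrt_eq_rpow, ← Real.rpow_neg hu0, ← Real.rpow_natCast, ← Real.rpow_mul hu0]
  congr 1
  ring

lemma exp_neg_mul_sum_sq {ι : Type*} [Fintype ι] (t : ℝ) (z : ι → ℝ) :
    Real.exp (-(t * ∑ i, z i ^ 2)) = ∏ i, Real.exp (-(t * z i ^ 2)) := by
  rw [← Real.exp_sum, Finset.sum_neg_distrib, Finset.mul_sum]

lemma integral_exp_neg_mul_sum_sq {ι : Type*} [Fintype ι] (μ : ι → ℝ) {v : ℝ≥0} (hv : v ≠ 0)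
    {t : ℝ} (ht : 0 ≤ t) :
    ∫ z, Real.exp (-(t * ∑ i, z i ^ 2)) ∂Measure.pi (fun i => gaussianReal (μ i) v) =
      sqLaplace (Fintype.card ι) v (∑ i, μ i ^ 2) t := by
  simp_rw [exp_neg_mul_sum_sq]
  rw [integral_fintype_prod_eq_prod (fun _ (x : ℝ) => Real.exp (-(t * x ^ 2))),
    ← prod_gaussian_factor μ v ht]
  refine Finset.prod_congr rfl fun i _ => ?_
  simpa using integral_mul_exp_neg_sq_gaussianReal (μ i) hv ht (fun _ => 1)

lemma integral_eval_mul_exp_neg_mul_sum_sq {ι : Type*} [Fintype ι] (μ : ι → ℝ) {v : ℝ≥0}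
    (hv : v ≠ 0) {t : ℝ} (ht : 0 ≤ t) (j : ι) :
    ∫ z, z j * Real.exp (-(t * ∑ i, z i ^ 2)) ∂Measure.pi (fun i => gaussianReal (μ i) v) =
      μ j / (1 + 2 * v * t) * sqLaplace (Fintype.card ι) v (∑ i, μ i ^ 2) t := by
  classical
  have h : ∀ z : ι → ℝ, z j * Real.exp (-(t * ∑ i, z i ^ 2)) =
      ∏ i, ((if i = j then z i else 1) * Real.exp (-(t * z i ^ 2))) := fun z => by
    rw [exp_neg_mul_sum_sq, Finset.prod_mul_distrib]
    simp
  simp_rw [h]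
  rw [integral_fintype_prod_eq_prod
    (fun i (x : ℝ) => (if i = j then x else 1) * Real.exp (-(t * x ^ 2))),
    ← prod_gaussian_factor μ v ht]
  have h2 : ∀ i, ∫ x, (if i = j then x else 1) * Real.exp (-(t * x ^ 2)) ∂gaussianReal (μ i) v =
      (if i = j then μ i / (1 + 2 * v * t) else 1) *
        ((√(1 + 2 * v * t))⁻¹ * Real.exp (-(t * μ i ^ 2 / (1 + 2 * v * t)))) := fun i => by
    rw [integral_mul_exp_neg_sq_gaussianReal (μ i) hv ht]
    split_ifs <;> simp [integral_id_gaussianReal, mul_comm]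
  simp_rw [h2]
  rw [Finset.prod_mul_distrib]
  simp

/-- Integrated bound on `sqLaplace` underlying the comparison of biases: the integrand is dominated
by minus the derivative of `(1 + (n - 2) v t) (1 + 2 v t) ^ (1 - n / 2) exp (-t m / (1 + 2 v t))`. -/
lemma intervalIntegral_sqLaplace_le {n v m T : ℝ} (hn : 4 ≤ n) (hv : 0 ≤ v)
    (hT : 0 ≤ T) :
    ∫ t in (0)..T, (1 + (n - 2) * v * t) * (m / (1 + 2 * v * t) * sqLaplace n v m t) ≤ 1 := by
  have hu : ∀ t ∈ Set.Icc 0 T, 0 < 1 + 2 * v * t := fun t ht => by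
    have := ht.1; positivity
  set W : ℝ → ℝ := fun t => (1 + (n - 2) * v * t) * ((1 + 2 * v * t) ^ (1 - n / 2) *
    Real.exp (-(t * m / (1 + 2 * v * t)))) with hW
  have key := intervalIntegral.integral_le_sub_of_hasDeriv_right_of_le (a := 0) (b := T)
    (g := fun t => -W t)
    (g' := fun t => (1 + (n - 2) * v * t) * (m / (1 + 2 * v * t) * sqLaplace n v m t) +
      (n - 2) * (n - 4) * v ^ 2 * t * sqLaplace n v m t)
    (φ := fun t => (1 + (n - 2) * v * t) * (m / (1 + 2 * v * t) * sqLaplace n v m t)) hT ?_ ?_ ?_ ?_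
  · have hW0 : W 0 = 1 := by simp [hW]
    have hWT : 0 ≤ W T := by
      have := hu T ⟨hT, le_rfl⟩
      have : 0 ≤ n - 2 := by linarith
      simp only [hW]
      positivity
    simp only [hW0] at key
    linarith
  · refine ContinuousOn.neg ?_
    simp only [hW]
    refine ContinuousOn.mul (by fun_prop) (ContinuousOn.mul ?_ ?_)
    · exact ContinuousOn.rpow_const (by fun_prop) fun t ht => Or.inl (hu t ht).ne'
    · exact Real.continuous_exp.comp_continuousOn
        ((ContinuousOn.div (by fun_prop) (by fun_prop) fun t ht => (hu t ht).ne').neg)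
  · intro t ht
    have hu0 := hu t ⟨ht.1.le, ht.2.le⟩
    refine HasDerivAt.hasDerivWithinAt ?_
    have d1 : HasDerivAt (fun t : ℝ => 1 + 2 * v * t) (2 * v) t := by
      simpa using ((hasDerivAt_id t).const_mul (2 * v)).const_add 1
    have d2 : HasDerivAt (fun t : ℝ => 1 + (n - 2) * v * t) ((n - 2) * v) t := by
      simpa using ((hasDerivAt_id t).const_mul ((n - 2) * v)).const_add 1
    have d3 := d1.rpow_const (p := 1 - n / 2) (Or.inl hu0.ne')
    have d4 := ((((hasDerivAt_id t).mul_const m).div d1 hu0.ne').neg).exp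
    refine (d2.mul (d3.mul d4)).neg.congr_deriv ?_
    have e1 : (1 + 2 * v * t) ^ (1 - n / 2) = (1 + 2 * v * t) ^ (-(n / 2)) * (1 + 2 * v * t) := by
      rw [← Real.rpow_add_one hu0.ne']; congr 1; ring
    have e2 : (1 - n / 2 - 1) = -(n / 2) := by ring
    simp only [e1, e2, sqLaplace, id, Pi.mul_apply, Pi.neg_apply, Pi.div_apply]
    field_simp
    ring
  · refine ContinuousOn.integrableOn_Icc ?_
    unfold sqLaplace
    refine ContinuousOn.mul (by fun_prop) (ContinuousOn.mul ?_ (ContinuousOn.mul ?_ ?_))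
    · exact ContinuousOn.div (by fun_prop) (by fun_prop) fun t ht => (hu t ht).ne'
    · exact ContinuousOn.rpow_const (by fun_prop) fun t ht => Or.inl (hu t ht).ne'
    · exact Real.continuous_exp.comp_continuousOn
        ((ContinuousOn.div (by fun_prop) (by fun_prop) fun t ht => (hu t ht).ne').neg)
  · intro t ht
    have hu0 := hu t ⟨ht.1.le, ht.2.le⟩
    have := ht.1
    have h1 : 0 ≤ n - 2 := by linarith
    have h2 : 0 ≤ n - 4 := by linarith
    have h3 : 0 ≤ sqLaplace n v m t := by unfold sqLaplace; positivity
    have : 0 ≤ (n - 2) * (n - 4) * v ^ 2 * t * sqLaplace n v m t := by positivity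
    simpa using this

lemma sqLaplace_nonneg {n v m t : ℝ} (hv : 0 ≤ v) (ht : 0 ≤ t) : 0 ≤ sqLaplace n v m t := by
  unfold sqLaplace; positivity

lemma sqLaplace_le {n v m t : ℝ} (hn : 4 ≤ n) (hv : 0 ≤ v) (hm : 0 ≤ m) (ht : 0 ≤ t) :
    sqLaplace n v m t ≤ ((1 + 2 * v * t) ^ 2)⁻¹ := by
  have hu : 1 ≤ 1 + 2 * v * t := by have : 0 ≤ 2 * v * t := by positivity
                                    linarith
  have h1 : (1 + 2 * v * t) ^ (-(n / 2)) ≤ ((1 + 2 * v * t) ^ 2)⁻¹ := by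
    rw [← Real.rpow_natCast, ← Real.rpow_neg (by linarith)]
    exact Real.rpow_le_rpow_of_exponent_le hu (by push_cast; linarith)
  have h2 : Real.exp (-(t * m / (1 + 2 * v * t))) ≤ 1 := by
    rw [Real.exp_le_one_iff, neg_nonpos]; positivity
  exact (mul_le_of_le_one_right (by positivity) h2).trans h1

lemma measurable_sqLaplace (n v m : ℝ) : Measurable (sqLaplace n v m) := by
  unfold sqLaplace; fun_prop

lemma integrableOn_sqrt_add_inv_mul_sqLaplace {n v m : ℝ} (hn : 4 ≤ n) (hv : 0 < v)
    (hm : 0 ≤ m) :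
    IntegrableOn (fun t => ((√t)⁻¹ + √t) * sqLaplace n v m (t / 2)) (Set.Ioi 0) := by
  have hmeas : Measurable (fun t => ((√t)⁻¹ + √t) * sqLaplace n v m (t / 2)) := by
    have := measurable_sqLaplace n v m
    fun_prop
  rw [← Set.Ioc_union_Ioi_eq_Ioi zero_le_one]
  refine IntegrableOn.union ?_ ?_
  · have h : IntegrableOn (fun t : ℝ => 2 * t ^ (-(1 / 2) : ℝ)) (Set.Ioc 0 1) :=
      ((intervalIntegrable_iff_integrableOn_Ioc_of_le zero_le_one).1
        (intervalIntegral.intervalIntegrable_rpow' (by norm_num))).const_mul 2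
    refine Integrable.mono' h hmeas.aestronglyMeasurable ?_
    refine (ae_restrict_iff' measurableSet_Ioc).2 (ae_of_all _ fun t ht => ?_)
    have ht0 : 0 < t := ht.1
    have hq : 0 < √t := Real.sqrt_pos.2 ht0
    have hq1 : √t ≤ 1 := Real.sqrt_le_one.2 ht.2
    have hG := sqLaplace_nonneg (n := n) (m := m) hv.le (t := t / 2) (by positivity)
    have hG1 : sqLaplace n v m (t / 2) ≤ 1 :=
      (sqLaplace_le hn hv.le hm (by positivity)).trans
        (inv_le_one_of_one_le₀ (one_le_pow₀ (by
          have : 0 ≤ 2 * v * (t / 2) := by positivity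
          linarith)))
    rw [Real.norm_of_nonneg (by positivity), Real.rpow_neg ht0.le, ← Real.sqrt_eq_rpow]
    have h3 : √t ≤ (√t)⁻¹ := hq1.trans (one_le_inv_iff₀.2 ⟨hq, hq1⟩)
    calc _ ≤ ((√t)⁻¹ + √t) * 1 := by gcongr
      _ ≤ _ := by linarith
  · have h : IntegrableOn (fun t : ℝ => 2 * (v ^ 2)⁻¹ * t ^ (-(3 / 2) : ℝ)) (Set.Ioi 1) :=
      (integrableOn_Ioi_rpow_of_lt (by norm_num) zero_lt_one).const_mul _
    refine Integrable.mono' h hmeas.aestronglyMeasurable ?_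
    refine (ae_restrict_iff' measurableSet_Ioi).2 (ae_of_all _ fun t ht => ?_)
    have ht1 : 1 < t := ht
    have ht0 : 0 < t := by linarith
    have hq : 0 < √t := Real.sqrt_pos.2 ht0
    have hq1 : 1 ≤ √t := Real.one_le_sqrt.2 ht1.le
    have hG := sqLaplace_nonneg (n := n) (m := m) hv.le (t := t / 2) (by positivity)
    have hG1 : sqLaplace n v m (t / 2) ≤ ((v * t) ^ 2)⁻¹ := by
      refine (sqLaplace_le hn hv.le hm (by positivity)).trans ?_
      gcongr
      linarith
    rw [Real.norm_of_nonneg (by positivity)]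
    have h3 : (√t)⁻¹ ≤ √t := (inv_le_one_of_one_le₀ hq1).trans hq1
    have h4 : t ^ (-(3 / 2) : ℝ) = √t * (t ^ 2)⁻¹ := by
      rw [Real.sqrt_eq_rpow, ← Real.rpow_natCast, ← Real.rpow_neg ht0.le, ← Real.rpow_add ht0]
      norm_num
    calc _ ≤ (√t + √t) * ((v * t) ^ 2)⁻¹ := by gcongr
      _ = _ := by rw [h4, mul_pow, mul_inv]; ring

lemma integrable_eval_mul_pow_mul_exp {ι : Type*} [Fintype ι] (hι : 4 ≤ Fintype.card ι)
    (μ : ι → ℝ) {v : ℝ≥0} (hv : v ≠ 0) (j : ι) {k : ℕ} (hk : k ≤ 1) :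
    Integrable (fun w : (ι → ℝ) × ℝ => w.1 j * (w.2 ^ k * Real.exp (-(w.2 * ∑ i, w.1 i ^ 2))))
      ((Measure.pi fun i => gaussianReal (μ i) v).prod (volume.restrict (Set.Ioi 0))) := by
  set N := Measure.pi fun i => gaussianReal (μ i) v
  have hv0 : (0 : ℝ) < v := by positivity
  have hdom : Integrable (fun w : (ι → ℝ) × ℝ =>
      ((√w.2)⁻¹ + √w.2) * Real.exp (-(w.2 / 2 * ∑ i, w.1 i ^ 2)))
      (N.prod (volume.restrict (Set.Ioi 0))) := by
    have hm : Measurable (fun w : (ι → ℝ) × ℝ =>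
      ((√w.2)⁻¹ + √w.2) * Real.exp (-(w.2 / 2 * ∑ i, w.1 i ^ 2))) := by fun_prop
    rw [integrable_prod_iff' hm.aestronglyMeasurable]
    constructor
    · refine (ae_restrict_iff' measurableSet_Ioi).2 (ae_of_all _ fun t ht => ?_)
      have ht0 : 0 < t := ht
      have hm' : Measurable (fun z : ι → ℝ => Real.exp (-(t / 2 * ∑ i, z i ^ 2))) := by fun_prop
      refine (Integrable.of_bound (μ := N) hm'.aestronglyMeasurable 1
        (ae_of_all _ fun z => ?_)).const_mul ((√t)⁻¹ + √t)
      rw [Real.norm_of_nonneg (Real.exp_pos _).le, Real.exp_le_one_iff, neg_nonpos]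
      positivity
    · refine IntegrableOn.congr_fun (integrableOn_sqrt_add_inv_mul_sqLaplace
        (n := Fintype.card ι) (v := v) (m := ∑ i, μ i ^ 2) (by exact_mod_cast hι) hv0
        (by positivity)) (fun t ht => ?_) measurableSet_Ioi
      have ht0 : 0 < t := ht
      have : ∀ z : ι → ℝ, ‖((√t)⁻¹ + √t) * Real.exp (-(t / 2 * ∑ i, z i ^ 2))‖ =
          ((√t)⁻¹ + √t) * Real.exp (-(t / 2 * ∑ i, z i ^ 2)) := fun z =>
        Real.norm_of_nonneg (by positivity)
      simp only [this]
      rw [integral_const_mul, integral_exp_neg_mul_sum_sq μ hv (by positivity)]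
  refine Integrable.mono' hdom (Measurable.aestronglyMeasurable (by fun_prop)) ?_
  have hae : ∀ᵐ w ∂(N.prod (volume.restrict (Set.Ioi (0 : ℝ)))), 0 < w.2 :=
    Measure.quasiMeasurePreserving_snd.ae
      ((ae_restrict_iff' measurableSet_Ioi).2 (ae_of_all _ fun t ht => ht))
  filter_upwards [hae] with w ht
  obtain ⟨z, t⟩ := w
  simp only at ht ⊢
  set A := ∑ i, z i ^ 2
  have hA : z j ^ 2 ≤ A := Finset.single_le_sum (f := fun i => z i ^ 2)
    (fun i _ => sq_nonneg _) (Finset.mem_univ j)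
  have hq : 0 < √t := Real.sqrt_pos.2 ht
  have hq2 : √t ^ 2 = t := Real.sq_sqrt ht.le
  have h1 : √t * |z j| ≤ Real.exp (t / 2 * A) := by
    have h2 : (√t * |z j|) ^ 2 ≤ t * A := by
      rw [mul_pow, hq2, sq_abs]; gcongr
    have h3 := Real.add_one_le_exp (t / 2 * A)
    nlinarith [sq_nonneg (√t * |z j| - 1)]
  have h4 : t ^ k ≤ ((√t)⁻¹ + √t) * √t := by
    have : ((√t)⁻¹ + √t) * √t = 1 + t := by
      rw [add_mul, inv_mul_cancel₀ hq.ne', ← sq, hq2]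
    rw [this]
    interval_cases k <;> simp [ht.le]
  have h5 : Real.exp (-(t * A)) = Real.exp (-(t / 2 * A)) * Real.exp (-(t / 2 * A)) := by
    rw [← Real.exp_add]; ring_nf
  have h6 : Real.exp (t / 2 * A) * Real.exp (-(t / 2 * A)) = 1 := by
    rw [← Real.exp_add]; simp
  rw [norm_mul, Real.norm_eq_abs, Real.norm_of_nonneg (by positivity), h5]
  calc |z j| * (t ^ k * (Real.exp (-(t / 2 * A)) * Real.exp (-(t / 2 * A))))
      ≤ |z j| * ((((√t)⁻¹ + √t) * √t) *
          (Real.exp (-(t / 2 * A)) * Real.exp (-(t / 2 * A)))) := by gcongr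
    _ = ((√t)⁻¹ + √t) * ((√t * |z j|) * Real.exp (-(t / 2 * A))) * Real.exp (-(t / 2 * A)) := by
        ring
    _ ≤ ((√t)⁻¹ + √t) * (Real.exp (t / 2 * A) * Real.exp (-(t / 2 * A))) *
          Real.exp (-(t / 2 * A)) := by gcongr
    _ = _ := by rw [h6, mul_one]

lemma setIntegral_pow_mul_exp_neg_mul {A : ℝ} (hA : 0 < A) {k : ℕ} (hk : k ≤ 1) :
    ∫ t in Set.Ioi 0, t ^ k * Real.exp (-(t * A)) = (A ^ (k + 1))⁻¹ := by
  have h := Real.integral_rpow_mul_exp_neg_mul_Ioi (a := k + 1) (r := A) (by positivity) hA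
  have hG : Real.Gamma (k + 1) = 1 := by
    rw [Real.Gamma_nat_eq_factorial]
    interval_cases k <;> simp
  rw [hG, mul_one, add_sub_cancel_right] at h
  simp only [Real.rpow_natCast] at h
  simp only [mul_comm _ A]
  rw [h, one_div, Real.inv_rpow hA.le, ← Nat.cast_succ, Real.rpow_natCast]

lemma ae_sum_sq_pos {ι : Type*} [Fintype ι] [Nonempty ι] (μ : ι → ℝ) {v : ℝ≥0} (hv : v ≠ 0) :
    ∀ᵐ z ∂Measure.pi (fun i => gaussianReal (μ i) v), 0 < ∑ i, z i ^ 2 := by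
  obtain ⟨j⟩ := ‹Nonempty ι›
  have := fun i => nullSingletonClass_gaussianReal (μ := μ i) hv
  have h : ∀ᵐ z ∂Measure.pi (fun i => gaussianReal (μ i) v), z j ≠ 0 := by
    rw [ae_iff]
    simpa using Measure.pi_hyperplane (fun i => gaussianReal (μ i) v) j 0
  filter_upwards [h] with z hz
  exact Finset.sum_pos' (fun i _ => sq_nonneg _) ⟨j, Finset.mem_univ _, by positivity⟩

lemma integrable_eval_div_sum_sq_pow {ι : Type*} [Fintype ι]
    (hι : 4 ≤ Fintype.card ι) (μ : ι → ℝ) {v : ℝ≥0} (hv : v ≠ 0)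
    (j : ι) {k : ℕ} (hk : k ≤ 1) :
    Integrable (fun z => z j / (∑ i, z i ^ 2) ^ (k + 1))
      (Measure.pi fun i => gaussianReal (μ i) v) := by
  have : Nonempty ι := ⟨j⟩
  refine (integrable_eval_mul_pow_mul_exp hι μ hv j hk).integral_prod_left.congr ?_
  filter_upwards [ae_sum_sq_pos μ hv] with z hz
  rw [integral_const_mul, setIntegral_pow_mul_exp_neg_mul hz hk, div_eq_mul_inv]

lemma integrableOn_pow_mul_sqLaplace_eval {ι : Type*} [Fintype ι]
    (hι : 4 ≤ Fintype.card ι) (μ : ι → ℝ) {v : ℝ≥0} (hv : v ≠ 0)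
    (j : ι) {k : ℕ} (hk : k ≤ 1) :
    IntegrableOn (fun t : ℝ => t ^ k * (μ j / (1 + 2 * v * t) *
      sqLaplace (Fintype.card ι) v (∑ i, μ i ^ 2) t)) (Set.Ioi 0) := by
  refine IntegrableOn.congr_fun
    (integrable_eval_mul_pow_mul_exp hι μ hv j hk).integral_prod_right
    (fun t ht => ?_) measurableSet_Ioi
  simp only [mul_left_comm _ (t ^ k)]
  rw [integral_const_mul, integral_eval_mul_exp_neg_mul_sum_sq μ hv (le_of_lt ht)]

lemma integral_eval_div_sum_sq_pow {ι : Type*} [Fintype ι]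
    (hι : 4 ≤ Fintype.card ι) (μ : ι → ℝ) {v : ℝ≥0} (hv : v ≠ 0)
    (j : ι) {k : ℕ} (hk : k ≤ 1) :
    ∫ z, z j / (∑ i, z i ^ 2) ^ (k + 1) ∂Measure.pi (fun i => gaussianReal (μ i) v) =
      ∫ t in Set.Ioi (0 : ℝ), t ^ k * (μ j / (1 + 2 * v * t) *
        sqLaplace (Fintype.card ι) v (∑ i, μ i ^ 2) t) := by
  have : Nonempty ι := ⟨j⟩
  have hswap := integral_integral_swap (f := fun (z : ι → ℝ) (t : ℝ) =>
    z j * (t ^ k * Real.exp (-(t * ∑ i, z i ^ 2)))) (integrable_eval_mul_pow_mul_exp hι μ hv j hk)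
  refine Eq.trans (integral_congr_ae ?_) (hswap.trans ?_)
  · filter_upwards [ae_sum_sq_pos μ hv] with z hz
    rw [integral_const_mul, setIntegral_pow_mul_exp_neg_mul hz hk, div_eq_mul_inv]
  · refine setIntegral_congr_fun measurableSet_Ioi fun t ht => ?_
    simp only [mul_left_comm _ (t ^ k)]
    rw [integral_const_mul, integral_eval_mul_exp_neg_mul_sum_sq μ hv (le_of_lt ht)]

lemma dotProduct_div_eq_sum {ι : Type*} [Fintype ι] (z μ : ι → ℝ) (a : ℝ) :
    (∑ i, z i * μ i) / a = ∑ i, μ i * (z i / a) := by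
  rw [Finset.sum_div]
  exact Finset.sum_congr rfl fun i _ => by ring

lemma integrable_sum_mul_div_sum_sq_pow {ι : Type*} [Fintype ι]
    (hι : 4 ≤ Fintype.card ι) (μ : ι → ℝ) {v : ℝ≥0} (hv : v ≠ 0) {k : ℕ} (hk : k ≤ 1) :
    Integrable (fun z => (∑ i, z i * μ i) / (∑ i, z i ^ 2) ^ (k + 1))
      (Measure.pi fun i => gaussianReal (μ i) v) := by
  simp_rw [dotProduct_div_eq_sum]
  exact integrable_finsetSum _ fun j _ =>
    (integrable_eval_div_sum_sq_pow hι μ hv j hk).const_mul _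

lemma sum_mul_pow_mul_sqLaplace {ι : Type*} [Fintype ι] (μ : ι → ℝ) (v g t : ℝ) (k : ℕ) :
    ∑ j, μ j * (t ^ k * (μ j / (1 + 2 * v * t) * g)) =
      t ^ k * ((∑ i, μ i ^ 2) / (1 + 2 * v * t) * g) := by
  rw [Finset.sum_div, Finset.sum_mul, Finset.mul_sum]
  exact Finset.sum_congr rfl fun i _ => by ring

lemma integrableOn_pow_mul_sqLaplace {ι : Type*} [Fintype ι]
    (hι : 4 ≤ Fintype.card ι) (μ : ι → ℝ) {v : ℝ≥0} (hv : v ≠ 0) {k : ℕ} (hk : k ≤ 1) :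
    IntegrableOn (fun t : ℝ => t ^ k * ((∑ i, μ i ^ 2) / (1 + 2 * v * t) *
      sqLaplace (Fintype.card ι) v (∑ i, μ i ^ 2) t)) (Set.Ioi 0) := by
  simp_rw [← sum_mul_pow_mul_sqLaplace]
  exact integrable_finsetSum _ fun j _ =>
    (integrableOn_pow_mul_sqLaplace_eval hι μ hv j hk).const_mul _

lemma integral_sum_mul_div_sum_sq_pow {ι : Type*} [Fintype ι]
    (hι : 4 ≤ Fintype.card ι) (μ : ι → ℝ) {v : ℝ≥0} (hv : v ≠ 0) {k : ℕ} (hk : k ≤ 1) :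
    ∫ z, (∑ i, z i * μ i) / (∑ i, z i ^ 2) ^ (k + 1)
        ∂Measure.pi (fun i => gaussianReal (μ i) v) =
      ∫ t in Set.Ioi (0 : ℝ), t ^ k * ((∑ i, μ i ^ 2) / (1 + 2 * v * t) *
        sqLaplace (Fintype.card ι) v (∑ i, μ i ^ 2) t) := by
  simp_rw [dotProduct_div_eq_sum, ← sum_mul_pow_mul_sqLaplace]
  rw [integral_finsetSum _ fun j _ =>
      (integrable_eval_div_sum_sq_pow hι μ hv j hk).const_mul _,
    integral_finsetSum _ fun j _ =>
      (integrableOn_pow_mul_sqLaplace_eval hι μ hv j hk).const_mul _]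
  refine Finset.sum_congr rfl fun j _ => ?_
  rw [integral_const_mul, integral_const_mul, integral_eval_div_sum_sq_pow hι μ hv j hk]

lemma integral_sum_mul_div_sum_sq_sq_pos {ι : Type*} [Fintype ι]
    (hι : 4 ≤ Fintype.card ι) {μ : ι → ℝ} (hμ : μ ≠ 0) {v : ℝ≥0} (hv : v ≠ 0) :
    0 < ∫ z, (∑ i, z i * μ i) / (∑ i, z i ^ 2) ^ 2
        ∂Measure.pi (fun i => gaussianReal (μ i) v) := by
  have hm : 0 < ∑ i, μ i ^ 2 := by
    obtain ⟨j, hj⟩ := Function.ne_iff.1 hμ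
    simp only [Pi.zero_apply] at hj
    exact Finset.sum_pos' (fun i _ => sq_nonneg _) ⟨j, Finset.mem_univ _, by positivity⟩
  have hpos : ∀ t : ℝ, 0 < t → 0 < t ^ 1 * ((∑ i, μ i ^ 2) / (1 + 2 * v * t) *
      sqLaplace (Fintype.card ι) v (∑ i, μ i ^ 2) t) := fun t ht => by
    unfold sqLaplace; positivity
  rw [integral_sum_mul_div_sum_sq_pow hι μ hv le_rfl,
    setIntegral_pos_iff_support_of_nonneg_ae
      ((ae_restrict_iff' measurableSet_Ioi).2 (ae_of_all _ fun t ht => (hpos t ht).le))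
      (integrableOn_pow_mul_sqLaplace hι μ hv le_rfl)]
  have hsub : Set.Ioi 0 ⊆ Function.support fun t : ℝ => t ^ 1 * ((∑ i, μ i ^ 2) /
      (1 + 2 * v * t) * sqLaplace (Fintype.card ι) v (∑ i, μ i ^ 2) t) :=
    fun t ht => (hpos t ht).ne'
  rw [Set.inter_eq_right.2 hsub]
  simp

lemma integral_sum_mul_div_sum_sq_add_le {ι : Type*} [Fintype ι]
    (hι : 4 ≤ Fintype.card ι) (μ : ι → ℝ) {v : ℝ≥0} (hv : v ≠ 0) :
    ∫ z, (∑ i, z i * μ i) / (∑ i, z i ^ 2) ∂Measure.pi (fun i => gaussianReal (μ i) v) +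
      (Fintype.card ι - 2) * v * ∫ z, (∑ i, z i * μ i) / (∑ i, z i ^ 2) ^ 2
        ∂Measure.pi (fun i => gaussianReal (μ i) v) ≤ 1 := by
  have h0 := integral_sum_mul_div_sum_sq_pow hι μ hv zero_le_one
  have h1 := integral_sum_mul_div_sum_sq_pow hι μ hv le_rfl
  have i0 := integrableOn_pow_mul_sqLaplace hι μ hv zero_le_one
  have i1 := (integrableOn_pow_mul_sqLaplace hι μ hv le_rfl).const_mul
    (((Fintype.card ι : ℝ) - 2) * v)
  rw [one_add_one_eq_two] at h1
  rw [zero_add] at h0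
  simp only [pow_one (∑ i, _)] at h0
  rw [h0, h1, ← integral_const_mul, ← integral_add i0 i1]
  refine le_of_tendsto (intervalIntegral_tendsto_integral_Ioi 0 (i0.add i1) Filter.tendsto_id)
    ((Filter.eventually_ge_atTop 0).mono fun T hT => ?_)
  refine le_of_eq_of_le (intervalIntegral.integral_congr fun t _ => ?_)
    (intervalIntegral_sqLaplace_le (n := Fintype.card ι) (v := v) (m := ∑ i, μ i ^ 2)
      (by exact_mod_cast hι) v.2 hT)
  ring

lemma integral_sum_sq_gaussianReal {ι : Type*} [Fintype ι] (v : ℝ≥0) :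
    Integrable (fun r : ι → ℝ => ∑ i, r i ^ 2) (Measure.pi fun _ => gaussianReal 0 v) ∧
    ∫ r, ∑ i, r i ^ 2 ∂Measure.pi (fun _ : ι => gaussianReal 0 v) = Fintype.card ι * v := by
  have hi : Integrable (fun x : ℝ => x ^ 2) (gaussianReal 0 v) :=
    (memLp_id_gaussianReal 2).integrable_sq
  have hint : ∀ i : ι, Integrable (fun r : ι → ℝ => r i ^ 2)
      (Measure.pi fun _ => gaussianReal 0 v) := fun i =>
    integrable_comp_eval (μ := fun _ : ι => gaussianReal 0 v) (i := i) hi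
  refine ⟨integrable_finsetSum _ fun i _ => hint i, ?_⟩
  have hv2 : ∫ x, x ^ 2 ∂gaussianReal 0 v = v := by
    have h := variance_fun_id_gaussianReal (μ := 0) (v := v)
    rw [variance_eq_integral (by fun_prop)] at h
    simpa [integral_id_gaussianReal] using h
  rw [integral_finsetSum _ fun i _ => hint i]
  have : ∀ i : ι, ∫ r : ι → ℝ, r i ^ 2 ∂Measure.pi (fun _ => gaussianReal 0 v) = v := fun i => by
    rw [← hv2]
    exact integral_comp_eval (μ := fun _ : ι => gaussianReal 0 v) (i := i) (f := fun x => x ^ 2)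
      hi.aestronglyMeasurable
  simp [this]

lemma dotProduct_annih_mulVec {ι : Type*} [Fintype ι] [DecidableEq ι] (b x y : ι → ℝ) :
    x ⬝ᵥ (annih b).mulVec y = x ⬝ᵥ y - (b ⬝ᵥ b)⁻¹ * ((x ⬝ᵥ b) * (b ⬝ᵥ y)) := by
  simp only [annih, sub_mulVec, one_mulVec, smul_mulVec, vecMulVec_mulVec, dotProduct_sub,
    dotProduct_smul, smul_eq_mul, op_smul_eq_smul]
  ring

lemma cfEst_bShrink {ℓ s : ℕ} {p : ℝ} (hp : 0 < p) {x : Fin ℓ ⊕ Fin s → ℝ}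
    (hA : 0 < ∑ i, x (Sum.inl i) ^ 2) (hR : 0 < ∑ j, x (Sum.inr j) ^ 2)
    (y : Fin ℓ ⊕ Fin s → ℝ) :
    cfEst (bShrink p x) x y =
      (∑ i, x (Sum.inl i) * y (Sum.inl i)) / (∑ i, x (Sum.inl i) ^ 2) *
        (1 + p * (∑ j, x (Sum.inr j) ^ 2) / ∑ i, x (Sum.inl i) ^ 2) -
      p * (∑ j, x (Sum.inr j) * y (Sum.inr j)) / ∑ i, x (Sum.inl i) ^ 2 := by
  set d := 1 - shrinkC p x with hd
  have hxx : x ⬝ᵥ x = (∑ i, x (Sum.inl i) ^ 2) + ∑ j, x (Sum.inr j) ^ 2 := by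
    simp [dotProduct, sq]
  have hxy : x ⬝ᵥ y = (∑ i, x (Sum.inl i) * y (Sum.inl i)) +
      ∑ j, x (Sum.inr j) * y (Sum.inr j) := by
    simp [dotProduct]
  have hby : ∀ y, bShrink p x ⬝ᵥ y = d * (∑ i, x (Sum.inl i) * y (Sum.inl i)) +
      ∑ j, x (Sum.inr j) * y (Sum.inr j) := fun y => by
    simp [dotProduct, bShrink, Finset.mul_sum, mul_assoc, hd]
  have hbx : x ⬝ᵥ bShrink p x = d * (∑ i, x (Sum.inl i) ^ 2) + ∑ j, x (Sum.inr j) ^ 2 := by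
    rw [dotProduct_comm, hby]; simp [sq]
  have hbb : bShrink p x ⬝ᵥ bShrink p x =
      d ^ 2 * (∑ i, x (Sum.inl i) ^ 2) + ∑ j, x (Sum.inr j) ^ 2 := by
    rw [hby, Finset.mul_sum, Finset.mul_sum]
    congr 1
    · exact Finset.sum_congr rfl fun i _ => by simp [bShrink, hd]; ring
    · exact Finset.sum_congr rfl fun i _ => by simp [bShrink]; ring
  have hbx' := hby x
  rw [cfEst, dotProduct_annih_mulVec, dotProduct_annih_mulVec, hbx, hbb, hxx, hxy, hby y,
    dotProduct_comm _ x, hbx]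
  rw [shrinkC] at hd
  set A := ∑ i, x (Sum.inl i) ^ 2
  set R := ∑ j, x (Sum.inr j) ^ 2
  set a := ∑ i, x (Sum.inl i) * y (Sum.inl i)
  set r := ∑ j, x (Sum.inr j) * y (Sum.inr j)
  have hB : 0 < d ^ 2 * A + R := by positivity
  have hc : 0 < A + p * R := by positivity
  have hden : A + R - (d ^ 2 * A + R)⁻¹ * ((d * A + R) * (d * A + R)) =
      A * R * (1 - d) ^ 2 / (d ^ 2 * A + R) := by
    field_simp; ring
  have hnum : a + r - (d ^ 2 * A + R)⁻¹ * ((d * A + R) * (d * a + r)) =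
      (1 - d) * (R * a - d * A * r) / (d ^ 2 * A + R) := by
    field_simp; ring
  have hd1 : 1 - d = A / (A + p * R) := by rw [hd]; ring
  have hd2 : d = p * R / (A + p * R) := by rw [hd]; field_simp; ring
  have hd0 : 0 < 1 - d := by rw [hd1]; positivity
  rw [hden, hnum, div_div_div_cancel_right₀ hB.ne']
  have : (1 - d) * (R * a - d * A * r) / (A * R * (1 - d) ^ 2) =
      (R * a - d * A * r) / (A * R * (1 - d)) := by
    field_simp
  rw [this, hd1, hd2]
  field_simp

lemma integral_dotProduct_lawYgiven {ℓ s : ℕ} (μ : Fin ℓ → ℝ) (β ρ σ τ : ℝ)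
    (x w : Fin ℓ ⊕ Fin s → ℝ) :
    ∫ y, ∑ i, w i * y i ∂(lawYgiven ℓ s μ β ρ σ τ x) =
      ∑ i, w i * (x i * β + (x i - Sum.elim μ (0 : Fin s → ℝ) i) * (ρ * σ / τ)) := by
  rw [lawYgiven, integral_finsetSum]
  · refine Finset.sum_congr rfl fun i _ => ?_
    rw [integral_const_mul]
    congr 1
    rw [integral_eval]
    exact integral_id_gaussianReal
  · intro i _
    exact (integrable_eval ((memLp_id_gaussianReal 1).integrable le_rfl)).const_mul _

lemma integral_twoStage_lawYgiven {ℓ s : ℕ} (μ : Fin ℓ → ℝ) (β ρ σ τ : ℝ)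
    {x : Fin ℓ ⊕ Fin s → ℝ} (hA : 0 < ∑ i, x (Sum.inl i) ^ 2) :
    ∫ y, (∑ i, y (Sum.inl i) * x (Sum.inl i)) / (∑ i, x (Sum.inl i) ^ 2)
        ∂(lawYgiven ℓ s μ β ρ σ τ x) =
      β + ρ * σ / τ - ρ * σ / τ *
        ((∑ i, x (Sum.inl i) * μ i) / ∑ i, x (Sum.inl i) ^ 2) := by
  set A := ∑ i, x (Sum.inl i) ^ 2 with hAdef
  have h := integral_dotProduct_lawYgiven μ β ρ σ τ x
    (Sum.elim (fun i => x (Sum.inl i) / A) 0)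
  have h1 : ∀ y : Fin ℓ ⊕ Fin s → ℝ, (∑ i, y (Sum.inl i) * x (Sum.inl i)) / A =
      ∑ i, Sum.elim (fun i => x (Sum.inl i) / A) (0 : Fin s → ℝ) i * y i := fun y => by
    simp only [Fintype.sum_sum_type, Sum.elim_inl, Sum.elim_inr, Pi.zero_apply, zero_mul,
      Finset.sum_const_zero, add_zero, Finset.sum_div]
    exact Finset.sum_congr rfl fun i _ => by ring
  simp_rw [h1]
  rw [h]
  have h2 : β + ρ * σ / τ - ρ * σ / τ * ((∑ i, x (Sum.inl i) * μ i) / A) =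
      ((∑ i, x (Sum.inl i) ^ 2) * (β + ρ * σ / τ) -
        ρ * σ / τ * ∑ i, x (Sum.inl i) * μ i) / A := by
    rw [← hAdef]; field_simp
  rw [h2]
  simp only [Fintype.sum_sum_type, Sum.elim_inl, Sum.elim_inr, Pi.zero_apply, zero_mul,
    Finset.sum_const_zero, add_zero, Finset.sum_mul, Finset.mul_sum, ← Finset.sum_sub_distrib,
    Finset.sum_div]
  exact Finset.sum_congr rfl fun i _ => by ring

lemma integral_cfEst_lawYgiven {ℓ s : ℕ} (μ : Fin ℓ → ℝ) (β ρ σ τ : ℝ) {p : ℝ} (hp : 0 < p)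
    {x : Fin ℓ ⊕ Fin s → ℝ} (hA : 0 < ∑ i, x (Sum.inl i) ^ 2)
    (hR : 0 < ∑ j, x (Sum.inr j) ^ 2) :
    ∫ y, cfEst (bShrink p x) x y ∂(lawYgiven ℓ s μ β ρ σ τ x) =
      β + ρ * σ / τ - ρ * σ / τ *
        ((∑ i, x (Sum.inl i) * μ i) / ∑ i, x (Sum.inl i) ^ 2) -
      ρ * σ / τ * p * ((∑ i, x (Sum.inl i) * μ i) / (∑ i, x (Sum.inl i) ^ 2) ^ 2 *
        ∑ j, x (Sum.inr j) ^ 2) := by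
  simp_rw [cfEst_bShrink hp hA hR]
  set A := ∑ i, x (Sum.inl i) ^ 2 with hAdef
  set R := ∑ j, x (Sum.inr j) ^ 2 with hRdef
  set q := (1 + p * R / A) / A with hq
  have h := integral_dotProduct_lawYgiven μ β ρ σ τ x
    (Sum.elim (fun i => q * x (Sum.inl i)) (fun j => -(p / A) * x (Sum.inr j)))
  have h1 : ∀ y : Fin ℓ ⊕ Fin s → ℝ, (∑ i, x (Sum.inl i) * y (Sum.inl i)) / A *
        (1 + p * R / A) - p * (∑ j, x (Sum.inr j) * y (Sum.inr j)) / A =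
      ∑ i, Sum.elim (fun i => q * x (Sum.inl i)) (fun j => -(p / A) * x (Sum.inr j)) i *
        y i := fun y => by
    simp only [Fintype.sum_sum_type, Sum.elim_inl, Sum.elim_inr, mul_assoc, ← Finset.mul_sum]
    rw [hq]; ring
  simp_rw [h1]
  rw [h]
  have h2 : ∑ i, x (Sum.inl i) * (x (Sum.inl i) * β + (x (Sum.inl i) - μ i) * (ρ * σ / τ)) =
      A * (β + ρ * σ / τ) - ρ * σ / τ * ∑ i, x (Sum.inl i) * μ i := by
    rw [hAdef, Finset.sum_mul, Finset.mul_sum, ← Finset.sum_sub_distrib]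
    exact Finset.sum_congr rfl fun i _ => by ring
  have h3 : ∑ j, x (Sum.inr j) * (x (Sum.inr j) * β + (x (Sum.inr j) - 0) * (ρ * σ / τ)) =
      R * (β + ρ * σ / τ) := by
    rw [hRdef, Finset.sum_mul]
    exact Finset.sum_congr rfl fun i _ => by ring
  simp only [Fintype.sum_sum_type, Sum.elim_inl, Sum.elim_inr, mul_assoc (q : ℝ),
    mul_assoc (-(p / A)), ← Finset.mul_sum, Pi.zero_apply, h2, h3]
  rw [hq]
  field_simp
  ring

lemma measurePreserving_lawX (ℓ s : ℕ) (μ : Fin ℓ → ℝ) (τ : ℝ) :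
    MeasurePreserving (MeasurableEquiv.sumPiEquivProdPi fun _ : Fin ℓ ⊕ Fin s => ℝ)
      (lawX ℓ s μ τ)
      ((Measure.pi fun i => gaussianReal (μ i) (τ ^ 2).toNNReal).prod
        (Measure.pi fun _ : Fin s => gaussianReal 0 (τ ^ 2).toNNReal)) :=
  measurePreserving_sumPiEquivProdPi (X := fun _ : Fin ℓ ⊕ Fin s => ℝ) fun i =>
    gaussianReal (Sum.elim μ (0 : Fin s → ℝ) i) (τ ^ 2).toNNReal

lemma integral_lawX_eq {ℓ s : ℕ} (hℓ : 4 ≤ ℓ) (hs : 1 ≤ s) (μ : Fin ℓ → ℝ) {τ : ℝ}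
    (hτ : 0 < τ) (c κ q : ℝ) {F : (Fin ℓ ⊕ Fin s → ℝ) → ℝ}
    (hF : ∀ x, 0 < ∑ i, x (Sum.inl i) ^ 2 → 0 < ∑ j, x (Sum.inr j) ^ 2 →
      F x = c - κ * ((∑ i, x (Sum.inl i) * μ i) / ∑ i, x (Sum.inl i) ^ 2) -
        q * ((∑ i, x (Sum.inl i) * μ i) / (∑ i, x (Sum.inl i) ^ 2) ^ 2 *
          ∑ j, x (Sum.inr j) ^ 2)) :
    ∫ x, F x ∂(lawX ℓ s μ τ) = c -
      κ * ∫ z, (∑ i, z i * μ i) / (∑ i, z i ^ 2)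
        ∂Measure.pi (fun i => gaussianReal (μ i) (τ ^ 2).toNNReal) -
      q * ((∫ z, (∑ i, z i * μ i) / (∑ i, z i ^ 2) ^ 2
        ∂Measure.pi (fun i => gaussianReal (μ i) (τ ^ 2).toNNReal)) * (s * τ ^ 2)) := by
  have hv : (τ ^ 2).toNNReal ≠ 0 := by simpa using hτ.ne'
  have : Nonempty (Fin ℓ) := ⟨⟨0, by omega⟩⟩
  have : Nonempty (Fin s) := ⟨⟨0, by omega⟩⟩
  have hcard : 4 ≤ Fintype.card (Fin ℓ) := by simpa using hℓ
  obtain ⟨hRi, hR⟩ := integral_sum_sq_gaussianReal (ι := Fin s) (τ ^ 2).toNNReal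
  have i0 := integrable_sum_mul_div_sum_sq_pow hcard μ hv zero_le_one
  have i1 := integrable_sum_mul_div_sum_sq_pow hcard μ hv le_rfl
  simp only [zero_add, pow_one, one_add_one_eq_two] at i0 i1
  have hae1 := ae_sum_sq_pos μ hv
  have hae2 := ae_sum_sq_pos (0 : Fin s → ℝ) hv
  simp only [Pi.zero_apply] at hae2
  set P := Measure.pi fun i => gaussianReal (μ i) (τ ^ 2).toNNReal
  set Q := Measure.pi fun _ : Fin s => gaussianReal 0 (τ ^ 2).toNNReal
  have hmp := measurePreserving_lawX ℓ s μ τ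
  rw [← hmp.symm.integral_comp' F]
  have hae : (fun w => F ((MeasurableEquiv.sumPiEquivProdPi fun _ : Fin ℓ ⊕ Fin s => ℝ).symm w))
      =ᵐ[P.prod Q] fun w => c - κ * ((∑ i, w.1 i * μ i) / ∑ i, w.1 i ^ 2) -
        q * ((∑ i, w.1 i * μ i) / (∑ i, w.1 i ^ 2) ^ 2 * ∑ j, w.2 j ^ 2) := by
    filter_upwards [Measure.quasiMeasurePreserving_fst.ae hae1,
      Measure.quasiMeasurePreserving_snd.ae hae2] with w h1 h2
    exact hF _ h1 h2
  rw [integral_congr_ae hae]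
  have j0 : Integrable (fun w : (Fin ℓ → ℝ) × (Fin s → ℝ) =>
      (∑ i, w.1 i * μ i) / ∑ i, w.1 i ^ 2) (P.prod Q) := i0.comp_fst Q
  have j1 : Integrable (fun w : (Fin ℓ → ℝ) × (Fin s → ℝ) =>
      (∑ i, w.1 i * μ i) / (∑ i, w.1 i ^ 2) ^ 2 * ∑ j, w.2 j ^ 2) (P.prod Q) := i1.mul_prod hRi
  have jc : Integrable (fun w : (Fin ℓ → ℝ) × (Fin s → ℝ) =>
      c - κ * ((∑ i, w.1 i * μ i) / ∑ i, w.1 i ^ 2)) (P.prod Q) :=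
    (integrable_const c).sub (j0.const_mul κ)
  rw [integral_sub jc (j1.const_mul q),
    integral_sub (integrable_const c) (j0.const_mul κ), integral_const_mul, integral_const_mul,
    integral_prod_mul (fun z : Fin ℓ → ℝ => (∑ i, z i * μ i) / (∑ i, z i ^ 2) ^ 2)
      (fun r : Fin s → ℝ => ∑ j, r j ^ 2), hR,
    integral_fun_fst (fun z : Fin ℓ → ℝ => (∑ i, z i * μ i) / ∑ i, z i ^ 2)]
  simp [Real.coe_toNNReal _ (sq_nonneg τ)]

/-- bias dominance through shrinkage. In the canonical two-stage
model with `ℓ ≥ 4` and `p ∈ (0, 2(ℓ−2)/s)`, let `β̂` be the control-function estimator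
with shrinkage factor `c(x*) = ‖x_z‖²/(‖x_z‖² + p‖x_r‖²)` and control vector
`b(X*) = ((1−c(X*))(X*_z)', (X*_r)')'`, and let `β̂_2SLS = (Y*_z)'X*_z/‖X*_z‖²`.
If `ρ ≠ 0` and `μ ≠ 0` then `|E[β̂] − β| < |E[β̂_2SLS] − β|`; if `ρ = 0` or `μ = 0`
then `|E[β̂] − β| = |E[β̂_2SLS] − β|`. Expectations over the joint law of `(X*, Y*)`
are written as iterated integrals against the marginal law of `X*` and the conditional
Gaussian law of `Y*` given `X*`. -/
theorem bias_dominance_through_shrinkage (ℓ s : ℕ) (hℓ : 4 ≤ ℓ) (hs : 1 ≤ s)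
    (μ : Fin ℓ → ℝ) (β ρ σ τ : ℝ)
    (hρ₁ : -1 < ρ) (hρ₂ : ρ < 1) (hσ : 0 < σ) (hτ : 0 < τ)
    (p : ℝ) (hp₁ : 0 < p) (hp₂ : p < 2 * ((ℓ : ℝ) - 2) / s)
    (Eβ E2SLS : ℝ)
    (hEβ : Eβ = ∫ x, ∫ y, cfEst (bShrink p x) x y
        ∂(lawYgiven ℓ s μ β ρ σ τ x) ∂(lawX ℓ s μ τ))
    (hE2SLS : E2SLS = ∫ x, ∫ y,
        (∑ i, y (Sum.inl i) * x (Sum.inl i)) / (∑ i, x (Sum.inl i) ^ 2)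
        ∂(lawYgiven ℓ s μ β ρ σ τ x) ∂(lawX ℓ s μ τ)) :
    (ρ ≠ 0 → μ ≠ 0 → |Eβ - β| < |E2SLS - β|) ∧
    (ρ = 0 ∨ μ = 0 → |Eβ - β| = |E2SLS - β|) := by
  have hv : (τ ^ 2).toNNReal ≠ 0 := by simpa using hτ.ne'
  have hcard : 4 ≤ Fintype.card (Fin ℓ) := by simpa using hℓ
  rw [integral_lawX_eq hℓ hs μ hτ (β + ρ * σ / τ) (ρ * σ / τ) (ρ * σ / τ * p)
    fun x hA hR => integral_cfEst_lawYgiven μ β ρ σ τ hp₁ hA hR] at hEβ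
  rw [integral_lawX_eq hℓ hs μ hτ (β + ρ * σ / τ) (ρ * σ / τ) 0
    fun x hA hR => by rw [integral_twoStage_lawYgiven μ β ρ σ τ hA, zero_mul, sub_zero]] at hE2SLS
  have hle := integral_sum_mul_div_sum_sq_add_le hcard μ hv
  rw [Fintype.card_fin, Real.coe_toNNReal _ (sq_nonneg τ)] at hle
  have hpos := fun hμ : μ ≠ 0 => integral_sum_mul_div_sum_sq_sq_pos hcard hμ hv
  have hzero : μ = 0 → ∫ z, (∑ i, z i * μ i) / (∑ i, z i ^ 2) ^ 2
      ∂Measure.pi (fun i => gaussianReal (μ i) (τ ^ 2).toNNReal) = 0 := fun h => by simp [h]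
  set D₁ := ∫ z, (∑ i, z i * μ i) / (∑ i, z i ^ 2)
    ∂Measure.pi (fun i => gaussianReal (μ i) (τ ^ 2).toNNReal)
  set D₂ := ∫ z, (∑ i, z i * μ i) / (∑ i, z i ^ 2) ^ 2
    ∂Measure.pi (fun i => gaussianReal (μ i) (τ ^ 2).toNNReal)
  have h1 : Eβ - β = ρ * σ / τ * (1 - D₁ - p * s * τ ^ 2 * D₂) := by rw [hEβ]; ring
  have h2 : E2SLS - β = ρ * σ / τ * (1 - D₁) := by rw [hE2SLS]; ring
  rw [h1, h2, abs_mul, abs_mul]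
  refine ⟨fun hρ hμ => ?_, ?_⟩
  · have hD := hpos hμ
    have hs0 : (0 : ℝ) < s := by exact_mod_cast hs
    rw [lt_div_iff₀ hs0] at hp₂
    have hτD : 0 < τ ^ 2 * D₂ := by positivity
    have hq : 0 < p * s * τ ^ 2 * D₂ := by positivity
    have hq2 : p * s * (τ ^ 2 * D₂) < 2 * (ℓ - 2) * (τ ^ 2 * D₂) :=
      mul_lt_mul_of_pos_right hp₂ hτD
    refine mul_lt_mul_of_pos_left ?_ (by positivity)
    have hpos1 : 0 < 1 - D₁ := by linarith
    rw [abs_of_pos hpos1, abs_lt]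
    constructor <;> linarith
  · rintro (rfl | h)
    · simp
    · simp [hzero h]
end

section
/- Let ℓ ≥ 3 be an integer, μ ∈ ℝ^ℓ with μ ≠ 0, τ > 0, and let M be a random vector in ℝ^ℓ with independent coordinates M_i ~ N(μ_i, τ²). With κ = ‖μ‖²/(2τ²), it holds that E[‖μ‖²/‖M‖²] = ∑_{k=0}^∞ (2κ/(ℓ−2+2k))·κ^k e^{−κ}/k!. -/
open MeasureTheory ProbabilityTheory

/-- The law of a random vector `M` in `ℝ^ℓ` with independent coordinates
`M_i ~ N(μ_i, τ²)`: the product of the real Gaussian measures. -/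
noncomputable def gaussianVecLaw (ℓ : ℕ) (μ : Fin ℓ → ℝ) (τ : ℝ) :
    Measure (Fin ℓ → ℝ) :=
  Measure.pi fun i => gaussianReal (μ i) (τ ^ 2).toNNReal

open Filter Topology Set

lemma lintegral_exp_neg_mul_Ioi_zero {a : ℝ} (ha : 0 < a) :
    ∫⁻ s in Ioi (0 : ℝ), ENNReal.ofReal (Real.exp (-(s * a))) = ENNReal.ofReal a⁻¹ := by
  have hint : IntegrableOn (fun s : ℝ => Real.exp (-(s * a))) (Ioi 0) := by
    simpa [mul_comm] using integrableOn_exp_mul_Ioi (neg_lt_zero.2 ha) 0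
  rw [← ofReal_integral_eq_lintegral_ofReal hint (ae_of_all _ fun s => (Real.exp_pos _).le)]
  congr 1
  have := integral_exp_mul_Ioi (neg_lt_zero.2 ha) 0
  simpa [mul_comm, neg_div] using this

lemma lintegral_one_add_mul_rpow_neg_Ioi_zero {a c : ℝ} (ha : 1 < a) (hc : 0 < c) :
    ∫⁻ s in Ioi (0 : ℝ), ENNReal.ofReal ((1 + c * s) ^ (-a))
      = ENNReal.ofReal (1 / (c * (a - 1))) := by
  have ha0 : a - 1 ≠ 0 := (sub_pos.2 ha).ne'
  have hderiv : ∀ s ∈ Ici (0 : ℝ), HasDerivAt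
      (fun s : ℝ => -(1 / (c * (a - 1))) * (1 + c * s) ^ (-(a - 1))) ((1 + c * s) ^ (-a)) s := by
    intro s hs
    have hpos : 0 < 1 + c * s := by have := mul_nonneg hc.le (mem_Ici.1 hs); linarith
    have h1 : HasDerivAt (fun s : ℝ => 1 + c * s) c s := by
      simpa using ((hasDerivAt_id s).const_mul c).const_add 1
    have h2 := (h1.rpow_const (p := -(a - 1)) (Or.inl hpos.ne')).const_mul (-(1 / (c * (a - 1))))
    refine h2.congr_deriv ?_
    rw [show -(a - 1) - 1 = -a by ring]
    field_simp
  have hnonneg : ∀ s ∈ Ioi (0 : ℝ), 0 ≤ (1 + c * s) ^ (-a) := fun s hs =>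
    Real.rpow_nonneg (by have := mul_pos hc (mem_Ioi.1 hs); linarith) _
  have hlim : Tendsto (fun s : ℝ => -(1 / (c * (a - 1))) * (1 + c * s) ^ (-(a - 1))) atTop
      (𝓝 0) := by
    have h1 : Tendsto (fun s : ℝ => 1 + c * s) atTop atTop :=
      tendsto_atTop_add_const_left _ _ (tendsto_id.const_mul_atTop hc)
    simpa using ((tendsto_rpow_neg_atTop (sub_pos.2 ha)).comp h1).const_mul (-(1 / (c * (a - 1))))
  rw [← ofReal_integral_eq_lintegral_ofReal
      (integrableOn_Ioi_deriv_of_nonneg' hderiv hnonneg hlim)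
      ((ae_restrict_mem measurableSet_Ioi).mono hnonneg),
    integral_Ioi_of_hasDerivAt_of_nonneg' hderiv hnonneg hlim]
  simp

lemma integral_exp_neg_mul_sq_gaussianReal (m : ℝ) {v : NNReal} (hv : v ≠ 0) {s : ℝ}
    (hs : 0 ≤ s) :
    ∫ x, Real.exp (-(s * x ^ 2)) ∂(gaussianReal m v)
      = (1 + 2 * v * s) ^ (-(1 / 2) : ℝ) * Real.exp (-(s * m ^ 2 / (1 + 2 * v * s))) := by
  have hvpos : (0 : ℝ) < v := NNReal.coe_pos.2 (pos_iff_ne_zero.2 hv)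
  have hpos : (0 : ℝ) < 1 + 2 * v * s := by positivity
  set d : NNReal := ⟨1 + 2 * v * s, hpos.le⟩
  have hdpos : 0 < d := hpos
  have hdv : (d : ℝ) = 1 + 2 * v * s := rfl
  rw [← hdv, integral_gaussianReal_eq_integral_smul hv]
  have key : ∀ x : ℝ, gaussianPDFReal m v x • Real.exp (-(s * x ^ 2))
      = ((d : ℝ) ^ (-(1 / 2) : ℝ) * Real.exp (-(s * m ^ 2 / d)))
        * gaussianPDFReal (m / d) (v / d) x := by
    intro x
    have hd0 : (d : ℝ) ≠ 0 := hpos.ne'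
    have hsq : Real.sqrt (2 * Real.pi * ↑(v / d)) = Real.sqrt (2 * Real.pi * v) / Real.sqrt d := by
      rw [← Real.sqrt_div (by positivity), NNReal.coe_div, mul_div_assoc]
    rw [gaussianPDFReal_def, gaussianPDFReal_def, Real.rpow_neg d.coe_nonneg,
      ← Real.sqrt_eq_rpow]
    simp only [hsq, smul_eq_mul]
    have hsd : Real.sqrt d ≠ 0 := (Real.sqrt_pos.2 hpos).ne'
    have hexp : -(x - m) ^ 2 / (2 * (v : ℝ)) + -(s * x ^ 2)
        = -(s * m ^ 2 / d) + -(x - m / d) ^ 2 / (2 * ((v / d : NNReal) : ℝ)) := by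
      rw [NNReal.coe_div]
      field_simp
      rw [hdv]
      ring
    rw [mul_assoc, ← Real.exp_add, hexp, Real.exp_add]
    field_simp
  simp_rw [key]
  rw [integral_const_mul,
    integral_gaussianPDFReal_eq_one _ (div_pos (pos_iff_ne_zero.2 hv) hdpos).ne',
    mul_one]

lemma lintegral_exp_neg_mul_sum_sq_pi_gaussianReal {ι : Type*} [Fintype ι] (μ : ι → ℝ)
    {v : NNReal} (hv : v ≠ 0) {s : ℝ} (hs : 0 ≤ s) :
    ∫⁻ m, ENNReal.ofReal (Real.exp (-(s * ∑ i, m i ^ 2)))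
        ∂(Measure.pi fun i => gaussianReal (μ i) v)
      = ENNReal.ofReal ((1 + 2 * v * s) ^ (-(Fintype.card ι / 2) : ℝ)
          * Real.exp (-(s * (∑ i, μ i ^ 2) / (1 + 2 * v * s)))) := by
  have hpos : (0 : ℝ) ≤ 1 + 2 * v * s := by positivity
  have hint : Integrable (fun m : ι → ℝ => Real.exp (-(s * ∑ i, m i ^ 2)))
      (Measure.pi fun i => gaussianReal (μ i) v) := by
    refine Integrable.of_bound (C := 1)
      (Measurable.aestronglyMeasurable (by fun_prop)) (ae_of_all _ fun m => ?_)
    rw [Real.norm_of_nonneg (Real.exp_pos _).le, Real.exp_le_one_iff, neg_nonpos]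
    positivity
  rw [← ofReal_integral_eq_lintegral_ofReal hint (ae_of_all _ fun m => (Real.exp_pos _).le)]
  congr 1
  simp_rw [Finset.mul_sum, ← Finset.sum_neg_distrib, Real.exp_sum]
  rw [integral_fintype_prod_eq_prod (fun _ x => Real.exp (-(s * x ^ 2)))]
  simp_rw [integral_exp_neg_mul_sq_gaussianReal _ hv hs]
  rw [Finset.prod_mul_distrib, Finset.prod_const, ← Real.exp_sum, Finset.card_univ,
    ← Real.rpow_natCast, ← Real.rpow_mul hpos, Finset.sum_neg_distrib, Finset.sum_div]
  congr 2
  ring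

lemma hasSum_rpow_mul_exp {κ d : ℝ} (hd : 0 < d) (b : ℝ) :
    HasSum (fun k : ℕ => κ ^ k * Real.exp (-κ) / k.factorial * d ^ (-(b + k)))
      (d ^ (-b) * Real.exp (-(κ * (d - 1) / d))) := by
  have h := (NormedSpace.expSeries_div_hasSum_exp (𝔸 := ℝ) (κ / d)).mul_left
    (d ^ (-b) * Real.exp (-κ))
  rw [← Real.exp_eq_exp_ℝ, mul_assoc, ← Real.exp_add] at h
  convert! h using 1
  · ext k
    rw [neg_add, Real.rpow_add hd, Real.rpow_neg hd.le (k : ℝ), Real.rpow_natCast, div_pow]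
    field_simp
  · congr 2
    field_simp
    ring

lemma lintegral_inv_sum_sq_pi_gaussianReal {ι : Type*} [Fintype ι] (hι : 3 ≤ Fintype.card ι)
    (μ : ι → ℝ) {v : NNReal} (hv : v ≠ 0) {κ : ℝ} (hκ : κ = (∑ i, μ i ^ 2) / (2 * v)) :
    ∫⁻ m, ENNReal.ofReal (∑ i, m i ^ 2)⁻¹ ∂(Measure.pi fun i => gaussianReal (μ i) v)
      = ∑' k : ℕ, ENNReal.ofReal (κ ^ k * Real.exp (-κ) / k.factorial
          * (1 / (2 * v * (Fintype.card ι / 2 + k - 1)))) := by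
  have hvpos : (0 : ℝ) < v := NNReal.coe_pos.2 (pos_iff_ne_zero.2 hv)
  have hκ0 : 0 ≤ κ := by rw [hκ]; positivity
  have hcard : (3 : ℝ) ≤ Fintype.card ι := by exact_mod_cast hι
  have : Nonempty ι := Fintype.card_pos_iff.1 (by omega)
  have : ∀ i, NullSingletonClass (gaussianReal (μ i) v) :=
    fun i => nullSingletonClass_gaussianReal hv
  have hne : ∀ᵐ m ∂(Measure.pi fun i => gaussianReal (μ i) v), m ≠ 0 := by
    rw [ae_iff]
    simp
  calc
    _ = ∫⁻ m, (∫⁻ s in Ioi (0 : ℝ), ENNReal.ofReal (Real.exp (-(s * ∑ i, m i ^ 2))))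
          ∂(Measure.pi fun i => gaussianReal (μ i) v) := by
      refine lintegral_congr_ae (hne.mono fun m hm => ?_)
      obtain ⟨i, hi⟩ := Function.ne_iff.1 hm
      exact (lintegral_exp_neg_mul_Ioi_zero (Finset.sum_pos' (fun j _ => sq_nonneg _)
        ⟨i, Finset.mem_univ i, sq_pos_of_ne_zero hi⟩)).symm
    _ = ∫⁻ s in Ioi (0 : ℝ), ∫⁻ m, ENNReal.ofReal (Real.exp (-(s * ∑ i, m i ^ 2)))
          ∂(Measure.pi fun i => gaussianReal (μ i) v) :=
      lintegral_lintegral_swap (by fun_prop)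
    _ = ∫⁻ s in Ioi (0 : ℝ), ∑' k : ℕ, ENNReal.ofReal (κ ^ k * Real.exp (-κ) / k.factorial)
          * ENNReal.ofReal ((1 + 2 * v * s) ^ (-(Fintype.card ι / 2 + k) : ℝ)) := by
      refine setLIntegral_congr_fun measurableSet_Ioi fun s hs => ?_
      have hs0 : 0 < s := hs
      have hpos : (0 : ℝ) < 1 + 2 * v * s := by positivity
      have h := hasSum_rpow_mul_exp (κ := κ) hpos (Fintype.card ι / 2)
      have hA : s * ∑ i, μ i ^ 2 = κ * (1 + 2 * v * s - 1) := by
        rw [hκ]; field_simp; ring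
      simp only [lintegral_exp_neg_mul_sum_sq_pi_gaussianReal μ hv hs0.le, hA]
      rw [← h.tsum_eq, ENNReal.ofReal_tsum_of_nonneg (fun k => by positivity) h.summable]
      exact tsum_congr fun k => ENNReal.ofReal_mul (by positivity)
    _ = _ := by
      rw [lintegral_tsum fun k => by fun_prop]
      refine tsum_congr fun k => ?_
      have hk : (0 : ℝ) ≤ k := k.cast_nonneg
      rw [lintegral_const_mul _ (by fun_prop),
        lintegral_one_add_mul_rpow_neg_Ioi_zero (by linarith) (by positivity),
        ← ENNReal.ofReal_mul (by positivity)]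

/-- Let `ℓ ≥ 3`, `μ ∈ ℝ^ℓ` with `μ ≠ 0`, `τ > 0`, and `M` a random
vector in `ℝ^ℓ` with independent coordinates `M_i ~ N(μ_i, τ²)`. With
`κ = ‖μ‖²/(2τ²)`, one has
`E[‖μ‖²/‖M‖²] = ∑_{k} (2κ/(ℓ−2+2k)) κ^k e^{−κ}/k!`
(the expectation of `2κ/(ℓ−2+2K)` for `K` Poisson with mean `κ`). -/
theorem gaussian_inverse_norm_sq_moment (ℓ : ℕ) (hℓ : 3 ≤ ℓ)
    (μ : Fin ℓ → ℝ) (hμ : μ ≠ 0) (τ : ℝ) (hτ : 0 < τ)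
    (κ : ℝ) (hκ : κ = (∑ i, μ i ^ 2) / (2 * τ ^ 2)) :
    (∫ m, (∑ i, μ i ^ 2) / (∑ i, m i ^ 2) ∂(gaussianVecLaw ℓ μ τ))
      = ∑' k : ℕ, (2 * κ / ((ℓ : ℝ) - 2 + 2 * k))
          * (κ ^ k * Real.exp (-κ) / (Nat.factorial k)) := by
  have hv : (τ ^ 2).toNNReal ≠ 0 := (Real.toNNReal_pos.2 (by positivity)).ne'
  have hvτ : ((τ ^ 2).toNNReal : ℝ) = τ ^ 2 := Real.coe_toNNReal _ (sq_nonneg τ)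
  have hκ0 : 0 ≤ κ := by rw [hκ]; positivity
  have hℓ' : (3 : ℝ) ≤ ℓ := by exact_mod_cast hℓ
  have hA : ∑ i, μ i ^ 2 = κ * (2 * τ ^ 2) := by rw [hκ]; field_simp
  simp_rw [div_eq_mul_inv (∑ i, μ i ^ 2)]
  rw [integral_const_mul, gaussianVecLaw, integral_eq_lintegral_of_nonneg_ae
      (ae_of_all _ fun m => by positivity)
      (Measurable.aestronglyMeasurable (by fun_prop)),
    lintegral_inv_sum_sq_pi_gaussianReal (by simpa using hℓ) μ hv (hκ.trans (by rw [hvτ])),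
    ENNReal.tsum_toReal_eq fun k => ENNReal.ofReal_ne_top, ← tsum_mul_left]
  refine tsum_congr fun k => ?_
  have hk : (0 : ℝ) ≤ k := k.cast_nonneg
  rw [hvτ, Fintype.card_fin, hA]
  have h1 : 0 < (ℓ : ℝ) / 2 + k - 1 := by linarith
  have h2 : (ℓ : ℝ) - 2 + 2 * k = 2 * (ℓ / 2 + k - 1) := by ring
  rw [h2]
  generalize (ℓ : ℝ) / 2 + k - 1 = t at h1
  rw [ENNReal.toReal_ofReal (by positivity)]
  field_simp
end

section
/- Let ℓ ≥ 4 be an integer and let K be a Poisson random variable with mean κ > 0. Then (ℓ−2)/2 + κ − 1/E[((ℓ−2)/2 + K)^{−1}] ≤ 1, where E[((ℓ−2)/2 + K)^{−1}] = ∑_{k=0}^∞ (1/((ℓ−2)/2 + k))·κ^k e^{−κ}/k!. (Consequently the bias-minimizing shrinkage level λ* = (ℓ−2)/((ℓ−2)/2 + κ − 1/E[((ℓ−2)/2 + K)^{−1}]) satisfies λ* ≥ ℓ − 2.) -/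
/-- The Poisson weights `κ ^ k * exp (-κ) / k!` sum to one. -/
theorem hasSum_poisson_weight (κ : ℝ) :
    HasSum (fun k : ℕ => κ ^ k * Real.exp (-κ) / (Nat.factorial k)) 1 := by
  have h := (NormedSpace.expSeries_div_hasSum_exp κ).mul_right (Real.exp (-κ))
  rw [← Real.exp_eq_exp_ℝ, ← Real.exp_add, add_neg_cancel, Real.exp_zero] at h
  exact h.congr_fun (fun k => by ring)

/-- Stein's identity `E[K f(K - 1)] = κ E[f(K)]` for a Poisson variable `K` of mean `κ`. -/
theorem hasSum_poisson_weight_shift {κ s : ℝ} {f g : ℕ → ℝ} (hg : g 0 = 0)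
    (hfg : ∀ k, g (k + 1) = (k + 1) * f k)
    (hf : HasSum (fun k : ℕ => f k * (κ ^ k * Real.exp (-κ) / (Nat.factorial k))) s) :
    HasSum (fun k : ℕ => g k * (κ ^ k * Real.exp (-κ) / (Nat.factorial k))) (κ * s) := by
  rw [← hasSum_nat_add_iff' 1]
  simp only [Finset.sum_range_one, hg, zero_mul, sub_zero]
  refine (hf.mul_left κ).congr_fun fun k => ?_
  rw [hfg, Nat.factorial_succ]
  push_cast
  have h1 : (k : ℝ) + 1 ≠ 0 := by positivity
  have h2 : (Nat.factorial k : ℝ) ≠ 0 := by positivity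
  field_simp
  ring

/-- A Poisson variable `K` of mean `κ` satisfies `1 / (a + κ) < E[1 / (a + K)]` and
`E[1 / (a + K)] ≤ 1 / (a - 1 + κ)` for `a ≥ 1`. -/
theorem poisson_inverse_moment_bounds {a κ E : ℝ} (ha : 1 ≤ a) (hκ : 0 < κ)
    (hE : HasSum (fun k : ℕ => 1 / (a + k)
      * (κ ^ k * Real.exp (-κ) / (Nat.factorial k))) E) :
    1 / (a + κ) < E ∧ (a - 1 + κ) * E ≤ 1 := by
  have hp := hasSum_poisson_weight κ
  have hp0 : ∀ k : ℕ, 0 < κ ^ k * Real.exp (-κ) / (Nat.factorial k) := fun k => by positivity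
  constructor
  · have hmean : HasSum (fun k : ℕ => (k : ℝ)
        * (κ ^ k * Real.exp (-κ) / (Nat.factorial k))) (κ * 1) :=
      hasSum_poisson_weight_shift (f := fun _ => 1) (by simp) (by simp) (by simpa using hp)
    have hm : 0 < a + κ := by linarith
    have htangent := (hp.mul_left ((a + 2 * κ) / (a + κ) ^ 2)).sub
      (hmean.mul_left (1 / (a + κ) ^ 2))
    have hgap : ∀ k : ℕ, 1 / (a + k) - ((a + 2 * κ) / (a + κ) ^ 2 - 1 / (a + κ) ^ 2 * k)
        = (κ - k) ^ 2 / ((a + k) * (a + κ) ^ 2) := fun k => by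
      have : 0 < a + k := by positivity
      field_simp
      ring
    have hlt := hasSum_lt (i := 0) (fun k => ?_) ?_ htangent hE
    · refine lt_of_eq_of_lt ?_ hlt
      field_simp
      ring
    · have h : 0 ≤ (κ - k) ^ 2 / ((a + k) * (a + κ) ^ 2) := by positivity
      rw [← hgap] at h
      have := mul_nonneg h (hp0 k).le
      linarith
    · have h : 0 < (κ - (0 : ℕ)) ^ 2 / ((a + (0 : ℕ)) * (a + κ) ^ 2) := by
        simp only [Nat.cast_zero, sub_zero, add_zero]
        positivity
      rw [← hgap] at h
      have := mul_pos h (hp0 0)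
      linarith
  · have hshift : HasSum (fun k : ℕ => (k : ℝ) / (a + k - 1)
        * (κ ^ k * Real.exp (-κ) / (Nat.factorial k))) (κ * E) :=
      hasSum_poisson_weight_shift (by simp) (fun k => by push_cast; ring) hE
    have hle := hasSum_le (fun k => ?_) ((hE.mul_left (a - 1)).add hshift) hp
    · linarith
    · rw [← mul_assoc, ← add_mul]
      refine mul_le_of_le_one_left (hp0 k).le ?_
      rcases Nat.eq_zero_or_pos k with rfl | hk
      · simp only [Nat.cast_zero, add_zero, zero_div, mul_one_div]
        rw [div_le_one (by linarith)]
        linarith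
      · have hk' : (1 : ℝ) ≤ k := by exact_mod_cast hk
        have h1 : 0 < a + k - 1 := by linarith
        have h2 : (a - 1) * (1 / (a + k)) ≤ (a - 1) * (1 / (a + k - 1)) := by
          gcongr
          linarith
        have h3 : (a - 1) * (1 / (a + k - 1)) + k / (a + k - 1) = 1 := by
          field_simp
          ring
        linarith

/-- Let `ℓ ≥ 4` be an integer and `K` a Poisson random variable with
mean `κ > 0`. With `E = E[((ℓ−2)/2 + K)⁻¹] = ∑_{k} (1/((ℓ−2)/2+k)) κ^k e^{−κ}/k!`,
it holds that `(ℓ−2)/2 + κ − 1/E ≤ 1`; consequently the bias-minimizing shrinkage level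
`λ* = (ℓ−2)/((ℓ−2)/2 + κ − 1/E)` satisfies `λ* ≥ ℓ − 2`. -/
theorem shrinkage_level_lower_bound (ℓ : ℕ) (hℓ : 4 ≤ ℓ) (κ : ℝ) (hκ : 0 < κ)
    (E : ℝ)
    (hE : E = ∑' k : ℕ, (1 / (((ℓ : ℝ) - 2) / 2 + k))
        * (κ ^ k * Real.exp (-κ) / (Nat.factorial k))) :
    ((ℓ : ℝ) - 2) / 2 + κ - 1 / E ≤ 1 ∧
      (ℓ : ℝ) - 2 ≤ ((ℓ : ℝ) - 2) / (((ℓ : ℝ) - 2) / 2 + κ - 1 / E) := by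
  have hℓ' : (4 : ℝ) ≤ ℓ := by exact_mod_cast hℓ
  have ha : 1 ≤ ((ℓ : ℝ) - 2) / 2 := by linarith
  generalize ((ℓ : ℝ) - 2) / 2 = a at ha hE ⊢
  have hsum : Summable (fun k : ℕ => 1 / (a + k)
      * (κ ^ k * Real.exp (-κ) / (Nat.factorial k))) := by
    refine (hasSum_poisson_weight κ).summable.of_nonneg_of_le (fun k => by positivity) fun k => ?_
    refine mul_le_of_le_one_left (by positivity) ?_
    rw [div_le_one (by positivity)]
    linarith [(Nat.cast_nonneg k : (0 : ℝ) ≤ k)]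
  obtain ⟨hlow, hupp⟩ := poisson_inverse_moment_bounds ha hκ (hE ▸ hsum.hasSum)
  have hm : 0 < a + κ := by linarith
  have hE0 : 0 < E := lt_trans (by positivity) hlow
  have hle : a - 1 + κ ≤ 1 / E := by rwa [le_div_iff₀ hE0]
  have hlt : 1 / E < a + κ := (one_div_lt hm hE0).mp hlow
  have hden : a + κ - 1 / E ≤ 1 := by linarith
  exact ⟨hden, le_div_self (by linarith) (by linarith) hden⟩
end
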